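/- arXiv:math/0703087 — 2 statements merged into one kernel-verified Lean document; each statement's English description precedes it below -/
import Mathlib

section
/- Let H ∈ (0,1), K ∈ (0,1) with 2HK = 1, and let B be a centered Gaussian process with covariance R as below. For t > 0 and n ≥ 1 set t_j = jt/n and V_t^n = Σ_{j=1}^{n} (B_{t_j} − B_{t_{j−1}})². Then E[V_t^n] converges to t/2^{K−1} = 2^{1−K} t as n → ∞. -/
open MeasureTheory ProbabilityTheory Filter

theorem aux_second_moment {Ω : Type*} [MeasurableSpace Ω] (P : Measure Ω)
    (X : Ω → ℝ) (v : NNReal) (h : P.map X = gaussianReal 0 v) :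
    Integrable (fun ω => X ω ^ 2) P ∧ ∫ ω, X ω ^ 2 ∂P = v := by
  have hX : AEMeasurable X P := by
    by_contra hn
    rw [Measure.map_of_not_aemeasurable hn] at h
    exact (IsProbabilityMeasure.ne_zero (gaussianReal 0 v)) h.symm
  have hm : MemLp (id : ℝ → ℝ) 2 (gaussianReal 0 v) := memLp_id_gaussianReal 2
  have hi : Integrable (fun x : ℝ => x ^ 2) (P.map X) := by
    rw [h]; exact hm.integrable_sq
  refine ⟨hi.comp_aemeasurable hX, ?_⟩
  have h1 : ∫ x, x ^ 2 ∂(P.map X) = ∫ ω, X ω ^ 2 ∂P :=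
    integral_map hX hi.aestronglyMeasurable
  rw [← h1, h]
  have h2 := variance_id_gaussianReal (μ := 0) (v := v)
  rw [variance_of_integral_eq_zero aemeasurable_id (by simp)] at h2
  simpa using h2

theorem aux_limit (p K : ℝ) (hK : K ∈ Set.Ioo (0:ℝ) 1) (hp : p * K = 1) :
    Tendsto (fun n : ℕ => ((n : ℝ) + 1) * (2 - 1 / ((n : ℝ) + 1)
      - 2 ^ (1 - K) * ((1 - 1 / ((n : ℝ) + 1)) ^ p + 1) ^ K)) atTop (nhds 0) := by
  have hd : HasDerivAt (fun x : ℝ => 2 - x - 2 ^ (1 - K) * ((1 - x) ^ p + 1) ^ K) 0 0 := by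
    have h0 : HasDerivAt (fun x : ℝ => 1 - x) (-1) 0 := by
      simpa using (hasDerivAt_id (0:ℝ)).const_sub 1
    have h1 := (h0.rpow_const (p := p) (by left; norm_num)).add_const 1
    have h2 := h1.rpow_const (p := K) (by left; norm_num)
    have h3 := h2.const_mul ((2:ℝ) ^ (1 - K))
    have h4 := ((hasDerivAt_id (0:ℝ)).const_sub 2).sub h3
    have e : (2:ℝ) ^ (1 - K) * 2 ^ (K - 1) = 1 := by
      rw [← Real.rpow_add (by norm_num)]; simp
    have e2 : -1 - 2 ^ (1 - K) * (-1 * p * (1 - 0) ^ (p - 1) * K *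
        (((1:ℝ) - 0) ^ p + 1) ^ (K - 1)) = 0 := by
      rw [sub_zero, Real.one_rpow, Real.one_rpow, one_add_one_eq_two]
      linear_combination (p * K) * e + hp
    rw [e2] at h4
    exact h4
  have hs := hd.tendsto_slope_zero
  have hx : Tendsto (fun n : ℕ => 1 / ((n : ℝ) + 1)) atTop (nhdsWithin 0 {0}ᶜ) := by
    refine tendsto_nhdsWithin_iff.2 ⟨tendsto_one_div_add_atTop_nhds_zero_nat, ?_⟩
    refine Eventually.of_forall fun n => ?_
    simp only [Set.mem_compl_iff, Set.mem_singleton_iff]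
    positivity
  refine (hs.comp hx).congr fun n => ?_
  have e : (2:ℝ) ^ (1 - K) * 2 ^ K = 2 := by
    rw [← Real.rpow_add (by norm_num)]; simp
  simp only [Function.comp, zero_add, sub_zero, Real.one_rpow, smul_eq_mul, one_div, inv_inv]
  rw [one_add_one_eq_two, e]
  ring

theorem aux_var (p K : ℝ) (hp : p * K = 1) (h x : ℝ)
    (hh : 0 < h) (hx : 1 ≤ x) (ts c : Fin 2 → ℝ) (hts : ts = ![x * h, (x - 1) * h])
    (hc : c = ![1, -1]) :
    (∑ i, ∑ j, c i * c j *
          (2 ^ (-K) * (((ts i) ^ p + (ts j) ^ p) ^ K - |ts i - ts j| ^ (p*K))))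
    = h * (2 ^ (1 - K) + x * (2 - 1 / x - 2 ^ (1 - K) * ((1 - 1 / x) ^ p + 1) ^ K)) := by
  have hx0 : 0 < x := by linarith
  have hy : 0 ≤ 1 - 1 / x := by
    rw [sub_nonneg, div_le_one hx0]; exact hx
  have ey : (x - 1) * h = (x * h) * (1 - 1 / x) := by field_simp
  have key : ∀ a : ℝ, 0 ≤ a → (2:ℝ) ^ (-K) * ((a ^ p + a ^ p) ^ K) = a := by
    intro a ha
    rw [← two_mul, Real.mul_rpow (by norm_num) (by positivity), ← Real.rpow_mul ha, hp,
      Real.rpow_one, ← mul_assoc, ← Real.rpow_add (by norm_num)]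
    simp
  have k1 := key (x * h) (by positivity)
  have k2 := key ((x - 1) * h) (mul_nonneg (by linarith) hh.le)
  have k3 : ((x * h) ^ p + ((x - 1) * h) ^ p) ^ K = (x * h) * ((1 - 1 / x) ^ p + 1) ^ K := by
    rw [ey, Real.mul_rpow (by positivity) hy,
      show (x * h) ^ p + (x * h) ^ p * (1 - 1 / x) ^ p = (x * h) ^ p * ((1 - 1 / x) ^ p + 1) by ring,
      Real.mul_rpow (by positivity) (by positivity), ← Real.rpow_mul (by positivity), hp,
      Real.rpow_one]
  have k4 : (2:ℝ) ^ (1 - K) = 2 * 2 ^ (-K) := by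
    rw [sub_eq_add_neg, Real.rpow_add (by norm_num), Real.rpow_one]
  have k5 : x * h - (x - 1) * h = h := by ring
  have k6 : (x - 1) * h - x * h = - h := by ring
  have k7 : x * (1 / x) = 1 := by field_simp
  subst hts hc
  simp only [Fin.sum_univ_two, Matrix.cons_val_zero, Matrix.cons_val_one, hp, Real.rpow_one,
    sub_self, abs_zero, sub_zero, k5, k6, abs_neg, abs_of_pos hh]
  rw [add_comm (((x - 1) * h) ^ p) ((x * h) ^ p), k1, k2, k3, k4]
  linear_combination h * k7

/-- Let `H ∈ (0,1)`, `K ∈ (0,1)` with `2HK = 1`, and let `B` be a centered Gaussian process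
with the bifractional covariance `R(t,s) = 2^{-K}((t^{2H} + s^{2H})^K - |t-s|^{2HK})`.
With `t_j = jt/n` and `V_t^n = ∑_{j=1}^n (B_{t_j} - B_{t_{j-1}})²`, one has
`E[V_t^n] → t/2^{K-1} = 2^{1-K} t` as `n → ∞`. -/
theorem bifBm_quadratic_variation_mean
    (H K : ℝ) (hH : H ∈ Set.Ioo (0:ℝ) 1) (hK : K ∈ Set.Ioo (0:ℝ) 1) (hHK : 2*H*K = 1)
    {Ω : Type*} [MeasurableSpace Ω] (P : Measure Ω) [IsProbabilityMeasure P]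
    (B : ℝ → Ω → ℝ)
    (hB : ∀ (m : ℕ) (ts : Fin m → ℝ) (c : Fin m → ℝ), (∀ i, 0 ≤ ts i) →
      P.map (fun ω => ∑ i, c i * B (ts i) ω) =
        gaussianReal 0 (Real.toNNReal (∑ i, ∑ j, c i * c j *
          (2 ^ (-K) * (((ts i) ^ (2*H) + (ts j) ^ (2*H)) ^ K - |ts i - ts j| ^ (2*H*K))))))
    (t : ℝ) (ht : 0 < t) :
    Tendsto (fun n : ℕ =>
        ∫ ω, (∑ j ∈ Finset.Icc 1 n,
          (B ((j : ℝ) * t / n) ω - B (((j : ℝ) - 1) * t / n) ω)^2) ∂P)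
      atTop (nhds (2 ^ ((1:ℝ) - K) * t)) := by
  have hp0 : 0 < 2 * H := by linarith [hH.1]
  set u : ℕ → ℝ := fun i => max (2 ^ (1 - K) + ((i : ℝ) + 1) * (2 - 1 / ((i : ℝ) + 1)
      - 2 ^ (1 - K) * ((1 - 1 / ((i : ℝ) + 1)) ^ (2 * H) + 1) ^ K)) 0 with hu
  have hul : Tendsto u atTop (nhds (2 ^ (1 - K))) := by
    have := ((aux_limit (2 * H) K hK hHK).const_add (2 ^ (1 - K))).max
      (tendsto_const_nhds (x := (0:ℝ)))
    rwa [add_zero, max_eq_left (by positivity)] at this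
  have hc := hul.cesaro.mul_const t
  refine hc.congr fun n => ?_
  rcases Nat.eq_zero_or_pos n with rfl | hn
  · simp
  have hn' : (0:ℝ) < n := by exact_mod_cast hn
  have hterm : ∀ i : ℕ, Integrable (fun ω => (B (((i + 1 : ℕ) : ℝ) * t / n) ω
      - B ((((i + 1 : ℕ) : ℝ) - 1) * t / n) ω) ^ 2) P ∧
      ∫ ω, (B (((i + 1 : ℕ) : ℝ) * t / n) ω
      - B ((((i + 1 : ℕ) : ℝ) - 1) * t / n) ω) ^ 2 ∂P = t / n * u i := by
    intro i
    have hth : 0 < t / n := by positivity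
    have h1 := hB 2 ![((i : ℝ) + 1) * (t / n), (((i : ℝ) + 1) - 1) * (t / n)] ![1, -1] (by
      intro k
      fin_cases k
      · simp; positivity
      · simp; positivity)
    rw [aux_var (2 * H) K hHK (t / n) ((i : ℝ) + 1) hth
      (by linarith [Nat.cast_nonneg (α := ℝ) i]) _ _ rfl rfl] at h1
    have h2 := aux_second_moment P _ _ h1
    rw [Real.coe_toNNReal'] at h2
    simp only [Fin.sum_univ_two, Matrix.cons_val_zero, Matrix.cons_val_one, one_mul, neg_mul,
      ← sub_eq_add_neg, ← mul_div_assoc] at h2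
    push_cast
    refine ⟨h2.1, h2.2.trans ?_⟩
    rw [hu]
    simp only
    rw [mul_max_of_nonneg _ _ hth.le, mul_zero, div_mul_eq_mul_div]
  have hsum : ∀ (f : ℕ → ℝ), ∑ j ∈ Finset.Icc 1 n, f j = ∑ i ∈ Finset.range n, f (i + 1) := by
    intro f
    clear hn hn' hterm
    induction n with
    | zero => simp
    | succ k ih => rw [Finset.sum_Icc_succ_top (by omega), Finset.sum_range_succ, ih]
  simp_rw [hsum]
  rw [integral_finsetSum _ (fun i _ => (hterm i).1),
    Finset.sum_congr rfl (fun i _ => (hterm i).2), ← Finset.mul_sum]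
  ring
end

section
/- Let H ∈ (0,1), K ∈ (0,1) with 2HK = 1, and let B be a centered Gaussian process with covariance R as below. For t > 0 and n ≥ 1 set t_j = jt/n and V_t^n = Σ_{j=1}^{n} (B_{t_j} − B_{t_{j−1}})². Then E[(V_t^n)²] converges to (t/2^{K−1})² as n → ∞. -/
open MeasureTheory ProbabilityTheory Filter

lemma aux_gauss4 (v : NNReal) : ∫ x, x^4 ∂(gaussianReal 0 v) = 3 * (v:ℝ)^2 := by
  have h1 : ∫ x, x^4 ∂(gaussianReal 0 v)
      = iteratedDeriv 4 (mgf (fun x ↦ x) (gaussianReal 0 v)) 0 := by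
    rw [iteratedDeriv_mgf_zero] <;> simp
  have hd : ∀ t : ℝ, HasDerivAt (fun t : ℝ => Real.exp (v * t^2/2))
      (v * t * Real.exp (v * t^2/2)) t := by
    intro t
    have := (((hasDerivAt_pow 2 t).const_mul (v:ℝ)).div_const 2).exp
    convert this using 1
    simp; ring
  have hp : ∀ (q : ℝ → ℝ) (q' : ℝ) (t : ℝ), HasDerivAt q q' t →
      HasDerivAt (fun t : ℝ => q t * Real.exp (v * t^2/2))
      ((q' + q t * (v * t)) * Real.exp (v * t^2/2)) t := by
    intro q q' t h
    have e := h.mul (hd t)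
    have e' : (q' + q t * (v * t)) * Real.exp (v * t^2/2) = q' * Real.exp (v * t^2/2) + q t * (v * t * Real.exp (v * t^2/2)) := by ring
    rw [e']
    exact e
  have e1 : deriv (fun t ↦ Real.exp (v * t ^ 2 / 2)) =
      fun t : ℝ ↦ (v * t) * Real.exp (v * t ^ 2 / 2) := by
    ext t; exact (hd t).deriv
  have e2 : deriv (fun t : ℝ ↦ (v * t) * Real.exp (v * t ^ 2 / 2)) =
      fun t : ℝ ↦ (v + v^2 * t^2) * Real.exp (v * t ^ 2 / 2) := by
    ext t
    rw [(hp (fun t => v * t) _ t ((hasDerivAt_id t).const_mul (v:ℝ))).deriv]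
    ring
  have e3 : deriv (fun t : ℝ ↦ (v + v^2 * t^2) * Real.exp (v * t ^ 2 / 2)) =
      fun t : ℝ ↦ (3 * v^2 * t + v^3 * t^3) * Real.exp (v * t ^ 2 / 2) := by
    ext t
    rw [(hp (fun t => v + v^2 * t^2) _ t
      (((hasDerivAt_pow 2 t).const_mul ((v:ℝ)^2)).const_add (v:ℝ))).deriv]
    push_cast; ring
  have e4 : deriv (fun t : ℝ ↦ (3 * v^2 * t + v^3 * t^3) * Real.exp (v * t ^ 2 / 2)) 0 =
      3 * (v:ℝ)^2 := by
    rw [(hp (fun t => 3 * v^2 * t + v^3 * t^3) _ 0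
      (((hasDerivAt_id (0:ℝ)).const_mul (3 * (v:ℝ)^2)).add
        ((hasDerivAt_pow 3 (0:ℝ)).const_mul ((v:ℝ)^3)))).deriv]
    simp
  rw [h1, mgf_fun_id_gaussianReal]
  simp only [zero_mul, zero_add]
  rw [iteratedDeriv_succ, iteratedDeriv_succ, iteratedDeriv_succ, iteratedDeriv_one, e1, e2, e3, e4]

lemma aux_gauss2 (v : NNReal) : ∫ x, x^2 ∂(gaussianReal 0 v) = (v:ℝ) := by
  have := variance_fun_id_gaussianReal (μ := 0) (v := v)
  rw [variance_eq_integral measurable_id'.aemeasurable] at this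
  simpa using this

section prob
variable {Ω : Type*} [MeasurableSpace Ω] {P : Measure Ω}

lemma aux_fsub {f g : Ω → ℝ} (hf : Integrable f P) (hg : Integrable g P) :
    Integrable (fun ω => f ω - g ω) P := hf.sub hg

lemma aux_meas {Z : Ω → ℝ} {v : NNReal} (h : P.map Z = gaussianReal 0 v) : AEMeasurable Z P :=
  aemeasurable_of_map_neZero (by rw [h]; infer_instance)

lemma aux_int2 {Z : Ω → ℝ} {v : NNReal} (h : P.map Z = gaussianReal 0 v) :
    ∫ ω, Z ω ^ 2 ∂P = v := by
  rw [← aux_gauss2 v, ← h, integral_map (aux_meas h) (by fun_prop)]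

lemma aux_int4 {Z : Ω → ℝ} {v : NNReal} (h : P.map Z = gaussianReal 0 v) :
    ∫ ω, Z ω ^ 4 ∂P = 3 * (v:ℝ)^2 := by
  rw [← aux_gauss4 v, ← h, integral_map (aux_meas h) (by fun_prop)]

lemma aux_memLp {Z : Ω → ℝ} {v : NNReal} (h : P.map Z = gaussianReal 0 v) :
    MemLp Z 4 P := by
  have := memLp_id_gaussianReal' (μ := 0) (v := v) 4 (by simp)
  rw [← h, memLp_map_measure_iff (by fun_prop) (aux_meas h)] at this
  exact this

lemma aux_i4 {Z : Ω → ℝ} {v : NNReal} (h : P.map Z = gaussianReal 0 v) :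
    Integrable (fun ω => Z ω ^ 4) P := by
  have := (aux_memLp h).integrable_norm_pow (p := 4) (by norm_num)
  refine this.congr (ae_of_all _ fun ω => ?_)
  simp only [Real.norm_eq_abs]
  exact (by decide : Even 4).pow_abs _

lemma aux_i2 [IsProbabilityMeasure P] {Z : Ω → ℝ} {v : NNReal} (h : P.map Z = gaussianReal 0 v) :
    Integrable (fun ω => Z ω ^ 2) P :=
  ((aux_memLp h).mono_exponent (by norm_num)).integrable_sq

lemma aux_pair2 [IsProbabilityMeasure P] {X Y : Ω → ℝ} {a b s : NNReal}
    (hX : P.map X = gaussianReal 0 a) (hY : P.map Y = gaussianReal 0 b)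
    (hs : P.map (fun ω => X ω + Y ω) = gaussianReal 0 s) :
    Integrable (fun ω => X ω * Y ω) P ∧
    ∫ ω, X ω * Y ω ∂P = ((s:ℝ) - a - b)/2 := by
  have e : (fun ω => X ω * Y ω) = fun ω => ((X ω + Y ω)^2 - X ω ^2 - Y ω ^2)/2 := by
    ext ω; ring
  have i1 := aux_i2 hX
  have i2 := aux_i2 hY
  have i3 := aux_i2 hs
  rw [e]
  refine ⟨((i3.sub i1).sub i2).div_const 2, ?_⟩
  rw [integral_div, integral_sub (aux_fsub i3 i1) i2, integral_sub i3 i1, aux_int2 hX, aux_int2 hY,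
    aux_int2 hs]

lemma aux_pair4 [IsProbabilityMeasure P] {X Y : Ω → ℝ} {a b s d : NNReal}
    (hX : P.map X = gaussianReal 0 a) (hY : P.map Y = gaussianReal 0 b)
    (hs : P.map (fun ω => X ω + Y ω) = gaussianReal 0 s)
    (hd : P.map (fun ω => X ω - Y ω) = gaussianReal 0 d) :
    Integrable (fun ω => X ω ^ 2 * Y ω ^ 2) P ∧
    ∫ ω, X ω ^ 2 * Y ω ^ 2 ∂P = (∫ ω, X ω * X ω ∂P) * (∫ ω, Y ω * Y ω ∂P)
      + 2 * (∫ ω, X ω * Y ω ∂P)^2 := by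
  have e : (fun ω => X ω ^ 2 * Y ω ^ 2) = fun ω =>
    ((X ω + Y ω)^4 + (X ω - Y ω)^4 - 2 * X ω ^4 - 2 * Y ω ^4)/12 := by
    ext ω; ring
  have i1 := (aux_i4 hX).const_mul 2
  have i2 := (aux_i4 hY).const_mul 2
  have i3 := aux_i4 hs
  have i4 := aux_i4 hd
  obtain ⟨i5, c⟩ := aux_pair2 hX hY hs
  have par : (s:ℝ) + d = 2 * a + 2 * b := by
    rw [← aux_int2 hs, ← aux_int2 hd, ← aux_int2 hX, ← aux_int2 hY,
      ← integral_add (aux_i2 hs) (aux_i2 hd), ← integral_const_mul, ← integral_const_mul,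
      ← integral_add ((aux_i2 hX).const_mul 2) ((aux_i2 hY).const_mul 2)]
    congr 1; ext ω; ring
  rw [e]
  refine ⟨(((i3.add i4).sub i1).sub i2).div_const 12, ?_⟩
  rw [integral_div, integral_sub (aux_fsub (i3.fun_add i4) i1) i2, integral_sub (i3.fun_add i4) i1,
    integral_add i3 i4, integral_const_mul, integral_const_mul,
    aux_int4 hX, aux_int4 hY, aux_int4 hs, aux_int4 hd, c]
  simp only [← pow_two]
  rw [aux_int2 hX, aux_int2 hY]
  have : (d:ℝ) = 2 * a + 2 * b - s := by linarith
  rw [this]; ring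

/-- abstract second moment -/
lemma aux_second [IsProbabilityMeasure P] (n : ℕ) (X : ℕ → Ω → ℝ)
    (h1 : ∀ i, i < n → ∃ v : NNReal, P.map (X i) = gaussianReal 0 v)
    (h2 : ∀ i j, i < n → j < n → ∃ v : NNReal, P.map (fun ω => X i ω + X j ω) = gaussianReal 0 v)
    (h3 : ∀ i j, i < n → j < n → ∃ v : NNReal, P.map (fun ω => X i ω - X j ω) = gaussianReal 0 v)
    (c : ℕ → ℕ → ℝ)
    (hc : ∀ i j, i < n → j < n → ∫ ω, X i ω * X j ω ∂P = c i j) :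
    ∫ ω, (∑ j ∈ Finset.range n, X j ω ^ 2)^2 ∂P =
      (∑ j ∈ Finset.range n, c j j)^2
      + 2 * ∑ i ∈ Finset.range n, ∑ j ∈ Finset.range n, c i j ^ 2 := by
  have key : ∀ i j, i < n → j < n → Integrable (fun ω => X i ω ^ 2 * X j ω ^ 2) P ∧
      ∫ ω, X i ω ^ 2 * X j ω ^ 2 ∂P = c i i * c j j + 2 * c i j ^ 2 := by
    intro i j hi hj
    obtain ⟨a, ha⟩ := h1 i hi
    obtain ⟨b, hb⟩ := h1 j hj
    obtain ⟨s, hs⟩ := h2 i j hi hj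
    obtain ⟨d, hd⟩ := h3 i j hi hj
    have := aux_pair4 ha hb hs hd
    rwa [hc i j hi hj, hc i i hi hi, hc j j hj hj] at this
  simp only [pow_two (∑ j ∈ Finset.range n, _), Finset.sum_mul_sum]
  rw [integral_finsetSum, Finset.mul_sum, ← Finset.sum_add_distrib]
  · refine Finset.sum_congr rfl fun i hi => ?_
    rw [integral_finsetSum, Finset.mul_sum, ← Finset.sum_add_distrib]
    · refine Finset.sum_congr rfl fun j hj => ?_
      exact (key i j (by simpa using hi) (by simpa using hj)).2
    · intro j hj
      exact (key i j (by simpa using hi) (by simpa using hj)).1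
  · intro i hi
    refine integrable_finsetSum _ fun j hj => ?_
    exact (key i j (by simpa using hi) (by simpa using hj)).1
end prob

noncomputable def auxF (p K x y : ℝ) : ℝ := (x^p + y^p)^K

noncomputable def auxD (p K : ℝ) (x y : ℝ) : ℝ :=
  auxF p K (x+1) (y+1) - auxF p K x (y+1) - auxF p K (x+1) y + auxF p K x y

lemma aux_submod {K a b s s' : ℝ} (hK0 : 0 < K) (hK1 : K < 1) (ha : 0 ≤ a) (hab : a ≤ b)
    (hs : 0 ≤ s) (hss : s ≤ s') :
    (b+s')^K + (a+s)^K ≤ (b+s)^K + (a+s')^K := by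
  have hc := Real.concaveOn_rpow hK0.le hK1.le
  rcases eq_or_lt_of_le (show 0 ≤ (b-a)+(s'-s) by linarith) with h | h
  · have e1 : b = a := by linarith
    have e2 : s' = s := by linarith
    rw [e1, e2]
  · set L := (b-a)+(s'-s) with hL
    have hsum : (s'-s)/L + (b-a)/L = 1 := by field_simp; linarith
    have hsum' : (b-a)/L + (s'-s)/L = 1 := by field_simp; linarith
    have q1 : 0 ≤ (s'-s)/L := div_nonneg (by linarith) h.le
    have q2 : 0 ≤ (b-a)/L := div_nonneg (by linarith) h.le
    have m1 : a + s ∈ Set.Ici (0:ℝ) := by simp; linarith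
    have m2 : b + s' ∈ Set.Ici (0:ℝ) := by simp; linarith
    have k1 := hc.2 m1 m2 q1 q2 hsum
    have k2 := hc.2 m1 m2 q2 q1 hsum'
    simp only [smul_eq_mul] at k1 k2
    have r1 : (s'-s)/L * (a+s) + (b-a)/L * (b+s') = b + s := by
      field_simp; rw [hL]; ring
    have r2 : (b-a)/L * (a+s) + (s'-s)/L * (b+s') = a + s' := by
      field_simp; rw [hL]; ring
    rw [r1] at k1
    rw [r2] at k2
    have : (b-a)/L = 1 - (s'-s)/L := by linarith
    rw [this] at k1 k2
    linarith

section F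
variable {p K : ℝ}

lemma auxF_submod (hp : 0 < p) (hK0 : 0 < K) (hK1 : K < 1) {x x' y y' : ℝ} (hx : 0 ≤ x)
    (hxx : x ≤ x') (hy : 0 ≤ y) (hyy : y ≤ y') :
    auxF p K x' y' + auxF p K x y ≤ auxF p K x' y + auxF p K x y' :=
  aux_submod hK0 hK1 (by positivity) (Real.rpow_le_rpow hx hxx hp.le) (by positivity)
    (Real.rpow_le_rpow hy hyy hp.le)

lemma auxF_zero_right (hp : 0 < p) (hpK : p * K = 1) {x : ℝ} (hx : 0 ≤ x) :
    auxF p K x 0 = x := by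
  rw [auxF, Real.zero_rpow hp.ne', add_zero, ← Real.rpow_mul hx, hpK, Real.rpow_one]

lemma auxF_comm (x y : ℝ) : auxF p K x y = auxF p K y x := by
  rw [auxF, auxF, add_comm]

lemma auxF_diag (hpK : p * K = 1) {x : ℝ} (hx : 0 ≤ x) :
    auxF p K x x = 2^K * x := by
  rw [auxF, ← two_mul, Real.mul_rpow (by norm_num) (by positivity), ← Real.rpow_mul hx, hpK,
    Real.rpow_one]

lemma auxF_hom (hpK : p * K = 1) {h x y : ℝ} (hh : 0 ≤ h) (hx : 0 ≤ x) (hy : 0 ≤ y) :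
    auxF p K (h * x) (h * y) = h * auxF p K x y := by
  rw [auxF, auxF, Real.mul_rpow hh hx, Real.mul_rpow hh hy, ← mul_add,
    Real.mul_rpow (by positivity) (by positivity), ← Real.rpow_mul hh, hpK, Real.rpow_one]

lemma auxD_nonpos (hp : 0 < p) (hK0 : 0 < K) (hK1 : K < 1) {x y : ℝ} (hx : 0 ≤ x) (hy : 0 ≤ y) :
    auxD p K x y ≤ 0 := by
  have := auxF_submod hp hK0 hK1 hx (by linarith : x ≤ x + 1) hy (by linarith : y ≤ y + 1)
  unfold auxD; linarith

lemma auxD_ge (hp : 0 < p) (hK0 : 0 < K) (hK1 : K < 1) (hpK : p * K = 1)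
    {x y : ℝ} (hx : 0 ≤ x) (hy : 0 ≤ y) :
    -1 ≤ auxD p K x y := by
  have h1 := auxF_submod hp hK0 hK1 hx (by linarith : x ≤ x + 1) le_rfl hy
  rw [auxF_zero_right hp hpK hx, auxF_zero_right hp hpK (by linarith : 0 ≤ x + 1)] at h1
  have h2 : auxF p K x (y+1) ≤ auxF p K (x+1) (y+1) := by
    unfold auxF
    gcongr
    linarith
  unfold auxD; linarith

lemma auxD_sum (hp : 0 < p) (hpK : p * K = 1) (n : ℕ) :
    ∑ i ∈ Finset.range n, ∑ j ∈ Finset.range n, auxD p K i j = (2^K - 2) * n := by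
  have h1 : ∀ i : ℕ, ∑ j ∈ Finset.range n, auxD p K i j =
      (auxF p K ((i+1 : ℕ):ℝ) n - auxF p K ((i+1:ℕ):ℝ) 0) - (auxF p K i n - auxF p K i 0) := by
    intro i
    have := Finset.sum_range_sub (fun j : ℕ => auxF p K ((i+1 : ℕ):ℝ) j - auxF p K i j) n
    have e : ∀ j : ℕ, auxD p K i j = (auxF p K ((i+1 : ℕ):ℝ) ((j+1:ℕ):ℝ) - auxF p K i ((j+1:ℕ):ℝ)) -
        (auxF p K ((i+1 : ℕ):ℝ) j - auxF p K i j) := by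
      intro j; unfold auxD; push_cast; ring
    rw [Finset.sum_congr rfl fun j _ => e j, this]
    push_cast; ring
  rw [Finset.sum_congr rfl fun i _ => h1 i,
    Finset.sum_range_sub (fun i : ℕ => auxF p K i n - auxF p K i 0) n]
  rw [auxF_diag hpK (by positivity), auxF_zero_right hp hpK (by positivity), Nat.cast_zero,
    auxF_comm 0, auxF_zero_right hp hpK (by positivity), auxF_zero_right hp hpK le_rfl]
  ring

lemma auxD_diag_tendsto (hp : 0 < p) (hpK : p * K = 1) :
    Tendsto (fun j : ℕ => auxD p K j j) atTop (nhds 0) := by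
  set φ : ℝ → ℝ := fun u => 2^K * (2 - u) - 2 * (1 + (1-u)^p)^K with hφ
  have hd : HasDerivAt φ 0 0 := by
    have h1 : HasDerivAt (fun u : ℝ => 1 - u) (-1) 0 := by
      simpa using (hasDerivAt_id (0:ℝ)).const_sub 1
    have h2 := (h1.rpow_const (p := p) (Or.inl (by norm_num))).const_add 1
    have h3 := (h2.rpow_const (p := K) (Or.inl (by norm_num))).const_mul 2
    have h4 : HasDerivAt (fun u : ℝ => 2^K * (2 - u)) (2^K * (-1)) 0 := by
      simpa using ((hasDerivAt_id (0:ℝ)).const_sub 2).const_mul ((2:ℝ)^K)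
    have h5 := h4.sub h3
    have e0 : (2:ℝ) ^ K * -1 - 2 * (-1 * p * (1 - 0) ^ (p - 1) * K * (1 + (1 - 0) ^ p) ^ (K - 1))
        = 0 := by
      simp only [sub_zero, Real.one_rpow]
      rw [one_add_one_eq_two, Real.rpow_sub_one (by norm_num)]
      linear_combination ((2:ℝ)^K) * hpK
    rw [e0] at h5
    exact h5
  have h0 : φ 0 = 0 := by simp [hφ]; norm_num; ring
  have hs := hd.tendsto_slope_zero
  simp only [zero_add, h0, sub_zero, smul_eq_mul] at hs
  have hseq : Tendsto (fun j : ℕ => (1:ℝ)/((j:ℝ)+1)) atTop (nhdsWithin 0 {0}ᶜ) := by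
    refine tendsto_nhdsWithin_iff.2 ⟨tendsto_one_div_add_atTop_nhds_zero_nat, ?_⟩
    refine Eventually.of_forall fun j => ?_
    have : (0:ℝ) < 1/((j:ℝ)+1) := by positivity
    exact this.ne'
  refine (hs.comp hseq).congr fun j => ?_
  have hj : (0:ℝ) < (j:ℝ)+1 := by positivity
  simp only [Function.comp, one_div, inv_inv, hφ]
  have hF : auxF p K ((j:ℝ)+1) j = ((j:ℝ)+1) * (1 + (1-((j:ℝ)+1)⁻¹)^p)^K := by
    have e : (j:ℝ) = ((j:ℝ)+1) * (1-((j:ℝ)+1)⁻¹) := by field_simp; ring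
    have hn : 0 ≤ 1-((j:ℝ)+1)⁻¹ := by
      have : ((j:ℝ)+1)⁻¹ ≤ 1 := inv_le_one_of_one_le₀ (by linarith [Nat.cast_nonneg (α := ℝ) j])
      linarith
    have := auxF_hom (h := (j:ℝ)+1) (x := 1) (y := 1-((j:ℝ)+1)⁻¹) hpK hj.le zero_le_one hn
    rw [← e, mul_one] at this
    rw [this, auxF, Real.one_rpow]
  unfold auxD
  rw [auxF_comm (j:ℝ) ((j:ℝ)+1), hF, auxF_diag hpK hj.le, auxF_diag hpK (Nat.cast_nonneg j)]
  field_simp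
  ring

end F

/-- deterministic limit -/
lemma aux_limit_s12 {p K t : ℝ} (hp : 0 < p) (hK0 : 0 < K) (hK1 : K < 1) (hpK : p * K = 1)
    (c : ℕ → ℕ → ℕ → ℝ)
    (hc : ∀ n i j, c n i j = t / n * 2^(-K) * (auxD p K i j + if i = j then 2 else 0)) :
    Tendsto (fun n : ℕ => (∑ j ∈ Finset.range n, c n j j)^2
      + 2 * ∑ i ∈ Finset.range n, ∑ j ∈ Finset.range n, c n i j ^ 2) atTop
      (nhds ((t / 2^(K-1))^2)) := by
  have h1 : Tendsto (fun n : ℕ => ∑ j ∈ Finset.range n, c n j j) atTop (nhds (t / 2^(K-1))) := by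
    have := ((auxD_diag_tendsto hp hpK).add_const 2).cesaro.const_mul (t * 2^(-K))
    have e : t / 2^(K-1) = t * 2^(-K) * (0 + 2) := by
      rw [Real.rpow_sub_one (by norm_num), Real.rpow_neg (by norm_num)]
      field_simp; norm_num
    rw [e]
    refine this.congr fun n => ?_
    rw [← mul_assoc, Finset.mul_sum]
    refine Finset.sum_congr rfl fun j _ => ?_
    rw [hc, if_pos rfl]; ring
  have h2 : Tendsto (fun n : ℕ => ∑ i ∈ Finset.range n, ∑ j ∈ Finset.range n, c n i j ^ 2)
      atTop (nhds 0) := by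
    have hb : Tendsto (fun n : ℕ => (t * 2^(-K))^2 * (6 - 2^K) * (1/(n:ℝ))) atTop (nhds 0) := by
      have := (tendsto_one_div_atTop_nhds_zero_nat (𝕜 := ℝ)).const_mul ((t * 2^(-K))^2 * (6 - 2^K))
      rwa [mul_zero] at this
    refine squeeze_zero (fun n => by positivity) (fun n => ?_) hb
    have hle : ∀ i j : ℕ, c n i j ^ 2 ≤
        (t / n * 2^(-K))^2 * (-auxD p K i j + if i = j then 4 else 0) := by
      intro i j
      rw [hc, mul_pow]
      refine mul_le_mul_of_nonneg_left ?_ (by positivity)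
      have a1 := auxD_nonpos hp hK0 hK1 (Nat.cast_nonneg (α := ℝ) i) (Nat.cast_nonneg (α := ℝ) j)
      have a2 := auxD_ge hp hK0 hK1 hpK (Nat.cast_nonneg (α := ℝ) i) (Nat.cast_nonneg (α := ℝ) j)
      split_ifs <;> nlinarith
    refine (Finset.sum_le_sum fun i _ => Finset.sum_le_sum fun j _ => hle i j).trans (le_of_eq ?_)
    simp only [← Finset.mul_sum, Finset.sum_add_distrib, Finset.sum_neg_distrib]
    rw [auxD_sum hp hpK]
    have : ∑ i ∈ Finset.range n, ∑ j ∈ Finset.range n, (if i = j then (4:ℝ) else 0) = 4 * n := by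
      rw [Finset.sum_congr rfl (g := fun _ => (4:ℝ))]
      · simp [mul_comm]
      · intro i hi
        rw [Finset.sum_ite_eq]; simp_all
    rw [this]
    rcases Nat.eq_zero_or_pos n with rfl | hn
    · simp
    · have : (0:ℝ) < n := by exact_mod_cast hn
      field_simp; ring
  simpa using (h1.pow 2).add (h2.const_mul 2)

/-- Let `H ∈ (0,1)`, `K ∈ (0,1)` with `2HK = 1`, and let `B` be a centered Gaussian process
with the bifractional covariance `R(t,s) = 2^{-K}((t^{2H} + s^{2H})^K - |t-s|^{2HK})`.
With `t_j = jt/n` and `V_t^n = ∑_{j=1}^n (B_{t_j} - B_{t_{j-1}})²`, one has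
`E[(V_t^n)²] → (t/2^{K-1})²` as `n → ∞`. -/
theorem bifBm_quadratic_variation_second_moment
    (H K : ℝ) (hH : H ∈ Set.Ioo (0:ℝ) 1) (hK : K ∈ Set.Ioo (0:ℝ) 1) (hHK : 2*H*K = 1)
    {Ω : Type*} [MeasurableSpace Ω] (P : Measure Ω) [IsProbabilityMeasure P]
    (B : ℝ → Ω → ℝ)
    (hB : ∀ (m : ℕ) (ts : Fin m → ℝ) (c : Fin m → ℝ), (∀ i, 0 ≤ ts i) →
      P.map (fun ω => ∑ i, c i * B (ts i) ω) =
        gaussianReal 0 (Real.toNNReal (∑ i, ∑ j, c i * c j *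
          (2 ^ (-K) * (((ts i) ^ (2*H) + (ts j) ^ (2*H)) ^ K - |ts i - ts j| ^ (2*H*K))))))
    (t : ℝ) (ht : 0 < t) :
    Tendsto (fun n : ℕ =>
        ∫ ω, ((∑ j ∈ Finset.Icc 1 n,
          (B ((j : ℝ) * t / n) ω - B (((j : ℝ) - 1) * t / n) ω)^2)^2) ∂P)
      atTop (nhds ((t / 2 ^ (K - 1))^2)) := by
  obtain ⟨hK0, hK1⟩ := hK
  have hp : 0 < 2 * H := by linarith [hH.1]
  rw [hHK] at hB
  simp only [Real.rpow_one] at hB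
  set R : ℝ → ℝ → ℝ := fun x y => 2 ^ (-K) * (auxF (2*H) K x y - |x - y|) with hR
  have hRnn : ∀ x y, 0 ≤ x → 0 ≤ y → 0 ≤ R x y := by
    have aux : ∀ x y, 0 ≤ x → x ≤ y → |x - y| ≤ auxF (2*H) K x y := by
      intro x y hx hxy
      have hy := hx.trans hxy
      have h1 := auxF_zero_right (K := K) hp hHK hy
      rw [auxF_comm] at h1
      have h2 : auxF (2*H) K 0 y ≤ auxF (2*H) K x y := by
        unfold auxF
        gcongr
      rw [abs_of_nonpos (by linarith)]
      linarith
    intro x y hx hy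
    refine mul_nonneg (by positivity) (sub_nonneg.2 ?_)
    rcases le_total x y with h | h
    · exact aux x y hx h
    · rw [abs_sub_comm, auxF_comm]; exact aux y x hy h
  have hRs : ∀ x y, R x y = R y x := by
    intro x y; simp only [hR]; rw [abs_sub_comm, auxF_comm]
  have hB1 : ∀ x, 0 ≤ x → P.map (B x) = gaussianReal 0 (Real.toNNReal (R x x)) := by
    intro x hx
    have := hB 1 ![x] ![1] (by simpa using hx)
    simpa [hR, auxF] using this
  have hB2 : ∀ x y, 0 ≤ x → 0 ≤ y → P.map (fun ω => B x ω + B y ω) =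
      gaussianReal 0 (Real.toNNReal (R x x + R x y + (R y x + R y y))) := by
    intro x y hx hy
    have := hB 2 ![x, y] ![1, 1] (by intro i; fin_cases i <;> simpa)
    simpa [hR, auxF, Fin.sum_univ_two] using this
  have hBB : ∀ x y, 0 ≤ x → 0 ≤ y → Integrable (fun ω => B x ω * B y ω) P ∧
      ∫ ω, B x ω * B y ω ∂P = R x y := by
    intro x y hx hy
    obtain ⟨h1, h2⟩ := aux_pair2 (hB1 x hx) (hB1 y hy) (hB2 x y hx hy)
    refine ⟨h1, ?_⟩
    have a1 := hRnn x x hx hx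
    have a2 := hRnn x y hx hy
    have a3 := hRnn y x hy hx
    have a4 := hRnn y y hy hy
    rw [h2, Real.coe_toNNReal _ a1, Real.coe_toNNReal _ a4, Real.coe_toNNReal _ (by linarith),
      hRs y x]
    ring
  set c : ℕ → ℕ → ℕ → ℝ := fun n i j =>
    t / n * 2^(-K) * (auxD (2*H) K i j + if i = j then 2 else 0) with hc
  refine (aux_limit_s12 (t := t) hp hK0 hK1 hHK c (fun _ _ _ => rfl)).congr fun n => ?_
  set T : ℕ → ℝ := fun i => t / n * i with hT
  have hT0 : ∀ i, 0 ≤ T i := fun i => by positivity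
  have hsum : ∀ ω, ∑ j ∈ Finset.Icc 1 n, (B ((j : ℝ) * t / n) ω - B (((j : ℝ) - 1) * t / n) ω)^2
      = ∑ j ∈ Finset.range n, (B (T (j+1)) ω - B (T j) ω)^2 := by
    intro ω
    rw [Finset.range_eq_Ico]
    refine Eq.trans ?_ ((Finset.sum_Ico_add' (fun j : ℕ =>
      (B ((j : ℝ) * t / n) ω - B (((j : ℝ) - 1) * t / n) ω)^2) 0 n 1).symm.trans ?_)
    · rfl
    · refine Finset.sum_congr rfl fun j _ => ?_
      have e1 : ((j+1:ℕ):ℝ) * t / n = T (j+1) := by simp only [hT]; ring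
      have e2 : (((j+1:ℕ):ℝ) - 1) * t / n = T j := by simp only [hT]; push_cast; ring
      rw [e1, e2]
  simp only [hsum]
  symm
  refine aux_second n (fun j ω => B (T (j+1)) ω - B (T j) ω) ?_ ?_ ?_ (c n) ?_
  · intro i _
    have := hB 2 ![T (i+1), T i] ![1, -1] (by intro k; fin_cases k <;> simp [hT0])
    simp only [Fin.sum_univ_two] at this
    exact ⟨_, by simpa [← sub_eq_add_neg] using this⟩
  · intro i j _ _
    have := hB 4 ![T (i+1), T i, T (j+1), T j] ![1, -1, 1, -1]
      (by intro k; fin_cases k <;> simp [hT0])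
    refine ⟨_, Eq.trans ?_ this⟩
    congr 1; ext ω; simp [Fin.sum_univ_four]; ring
  · intro i j _ _
    have := hB 4 ![T (i+1), T i, T (j+1), T j] ![1, -1, -1, 1]
      (by intro k; fin_cases k <;> simp [hT0])
    refine ⟨_, Eq.trans ?_ this⟩
    congr 1; ext ω; simp [Fin.sum_univ_four]; ring
  · intro i j _ _
    obtain ⟨i1, v1⟩ := hBB (T (i+1)) (T (j+1)) (hT0 _) (hT0 _)
    obtain ⟨i2, v2⟩ := hBB (T i) (T (j+1)) (hT0 _) (hT0 _)
    obtain ⟨i3, v3⟩ := hBB (T (i+1)) (T j) (hT0 _) (hT0 _)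
    obtain ⟨i4, v4⟩ := hBB (T i) (T j) (hT0 _) (hT0 _)
    have e : (fun ω => (B (T (i+1)) ω - B (T i) ω) * (B (T (j+1)) ω - B (T j) ω)) = fun ω =>
        B (T (i+1)) ω * B (T (j+1)) ω - B (T i) ω * B (T (j+1)) ω - B (T (i+1)) ω * B (T j) ω
          + B (T i) ω * B (T j) ω := by
      ext ω; ring
    simp only [e]
    rw [integral_add (aux_fsub (aux_fsub i1 i2) i3) i4, integral_sub (aux_fsub i1 i2) i3, integral_sub i1 i2,
      v1, v2, v3, v4]
    have hh : 0 ≤ t / n := by positivity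
    have hRT : ∀ a b : ℕ, R (T a) (T b) = t / n * 2^(-K) * (auxF (2*H) K a b - |(a:ℝ) - b|) := by
      intro a b
      simp only [hR, hT]
      rw [auxF_hom hHK hh (Nat.cast_nonneg a) (Nat.cast_nonneg b), ← mul_sub, abs_mul,
        abs_of_nonneg hh]
      ring
    have habs : -|((i+1:ℕ):ℝ) - ((j+1:ℕ):ℝ)| + |(i:ℝ) - ((j+1:ℕ):ℝ)| + |((i+1:ℕ):ℝ) - j|
        - |(i:ℝ) - j| = if i = j then 2 else 0 := by
      push_cast
      rcases lt_trichotomy i j with h | h | h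
      · have : (i:ℝ) + 1 ≤ j := by exact_mod_cast h
        rw [if_neg h.ne, abs_of_nonpos (by linarith), abs_of_nonpos (by linarith),
          abs_of_nonpos (by linarith), abs_of_nonpos (by linarith)]
        ring
      · subst h
        simp; norm_num
      · have : (j:ℝ) + 1 ≤ i := by exact_mod_cast h
        rw [if_neg h.ne', abs_of_nonneg (by linarith), abs_of_nonneg (by linarith),
          abs_of_nonneg (by linarith), abs_of_nonneg (by linarith)]
        ring
    rw [hRT, hRT, hRT, hRT]
    simp only [hc]
    rw [← habs]
    unfold auxD
    push_cast
    ring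
end
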